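/- Let X = X₁ ∪ X₂ ∪ X₃ ⊆ ℝ² be the Warsaw circle, where X₁ = {(a, |sin(π/a)|) : a ∈ (0,1]}, X₂ = {(a,b) ∈ ℝ² : (a − 1/2)² + b² = 1/4 and b < 0}, and X₃ = {(0,b) : b ∈ [0,1]}, with the subspace topology of ℝ². Then the hyperspace S_c(X) has exactly 𝔠-many path-wise connected components, i.e. the set of path components of S_c(X) has cardinality continuum. -/

import Mathlib

open Set Topology

/-- The Vietoris topology on the powerset of a topological space, generated by the
standard subbasis.  Restricting it to any family of closed subsets yields the usual
Vietoris hyperspace topology on that family. -/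
def vietorisTopology (X : Type*) [TopologicalSpace X] : TopologicalSpace (Set X) :=
  TopologicalSpace.generateFrom
    {A | (∃ U : Set X, IsOpen U ∧ A = {F : Set X | F ⊆ U}) ∨
         (∃ U : Set X, IsOpen U ∧ A = {F : Set X | (F ∩ U).Nonempty})}

/-- `S` is a nontrivial convergent sequence with limit point `x`:  `S` is countably
infinite, closed, `x` is its unique non-isolated point, and `S \ U` is finite for
every open neighbourhood `U` of `x`. -/
def IsNCS {X : Type*} [TopologicalSpace X] (S : Set X) (x : X) : Prop :=
  S.Infinite ∧ S.Countable ∧ IsClosed S ∧ x ∈ S ∧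
    (¬ ∃ U : Set X, IsOpen U ∧ U ∩ S = {x}) ∧
    (∀ y ∈ S, y ≠ x → ∃ U : Set X, IsOpen U ∧ U ∩ S = {y}) ∧
    (∀ U : Set X, IsOpen U → x ∈ U → (S \ U).Finite)

/-- The hyperspace `S_c(X)` of all nontrivial convergent sequences of `X`. -/
def Sc (X : Type*) [TopologicalSpace X] : Type _ :=
  {S : Set X // ∃ x, IsNCS S x}

/-- `S_c(X)` carries the relative Vietoris topology. -/
instance (X : Type*) [TopologicalSpace X] : TopologicalSpace (Sc X) :=
  TopologicalSpace.induced (fun S => S.1) (vietorisTopology X)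

/-- The Warsaw circle `X = X₁ ∪ X₂ ∪ X₃ ⊆ ℝ²`. -/
noncomputable def warsawCircle : Set (ℝ × ℝ) :=
  {p : ℝ × ℝ | ∃ a ∈ Set.Ioc (0:ℝ) 1, p = (a, |Real.sin (Real.pi / a)|)} ∪
  {p : ℝ × ℝ | (p.1 - 1/2)^2 + p.2^2 = 1/4 ∧ p.2 < 0} ∪
  {p : ℝ × ℝ | p.1 = 0 ∧ p.2 ∈ Set.Icc (0:ℝ) 1}

lemma isNCS_of_seq {X : Type*} [TopologicalSpace X] [T2Space X] (f : ℕ → X) (x : X)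
    (hf : Function.Injective f) (hx : ∀ n, f n ≠ x) (ht : Filter.Tendsto f Filter.atTop (𝓝 x)) :
    IsNCS (insert x (range f)) x := by
  have hfin : ∀ U : Set X, IsOpen U → x ∈ U → ((insert x (range f)) \ U).Finite := by
    intro U hU hxU
    have h1 := ht.eventually (hU.mem_nhds hxU)
    obtain ⟨N, hN⟩ := Filter.eventually_atTop.1 h1
    refine ((Set.finite_Iio N).image f).subset ?_
    rintro y ⟨hy, hyU⟩
    rcases hy with rfl | ⟨n, rfl⟩
    · exact absurd hxU hyU
    · refine ⟨n, ?_, rfl⟩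
      by_contra h
      exact hyU (hN n (not_lt.1 h))
  refine ⟨(Set.infinite_range_of_injective hf).mono (subset_insert _ _),
    (countable_range f).insert x, ht.isCompact_insert_range.isClosed, mem_insert _ _, ?_, ?_, hfin⟩
  · rintro ⟨U, hU, hUS⟩
    have hxU : x ∈ U := by
      have : x ∈ U ∩ insert x (range f) := by rw [hUS]; rfl
      exact this.1
    obtain ⟨n, hn⟩ := (ht.eventually (hU.mem_nhds hxU)).exists
    have : f n ∈ U ∩ insert x (range f) := ⟨hn, Or.inr ⟨n, rfl⟩⟩
    rw [hUS] at this
    exact hx n this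
  · intro y hy hyx
    obtain ⟨V, U, hV, hU, hyV, hxU, hd⟩ := t2_separation hyx
    refine ⟨V \ ((insert x (range f) \ U) \ {y}),
      hV.sdiff ((hfin U hU hxU).subset diff_subset).isClosed, ?_⟩
    ext z
    constructor
    · rintro ⟨⟨hzV, hz⟩, hzS⟩
      by_contra hzy
      exact hz ⟨⟨hzS, fun hzU => Set.disjoint_left.1 hd hzV hzU⟩, hzy⟩
    · intro hzy
      have hzy : z = y := hzy
      subst hzy
      exact ⟨⟨hyV, fun h => h.2 rfl⟩, hy⟩

lemma isOpen_sub {X : Type*} [TopologicalSpace X] {U : Set X} (hU : IsOpen U) :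
    IsOpen {F : Sc X | F.1 ⊆ U} := by
  letI := vietorisTopology X
  refine isOpen_induced_iff.2 ⟨{F : Set X | F ⊆ U}, ?_, rfl⟩
  exact TopologicalSpace.isOpen_generateFrom_of_mem (Or.inl ⟨U, hU, rfl⟩)

lemma isOpen_meet {X : Type*} [TopologicalSpace X] {U : Set X} (hU : IsOpen U) :
    IsOpen {F : Sc X | (F.1 ∩ U).Nonempty} := by
  letI := vietorisTopology X
  refine isOpen_induced_iff.2 ⟨{F : Set X | (F ∩ U).Nonempty}, ?_, rfl⟩
  exact TopologicalSpace.isOpen_generateFrom_of_mem (Or.inr ⟨U, hU, rfl⟩)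

lemma warsaw_pos {p : ℝ × ℝ} (hp : p ∈ warsawCircle) (h1 : 0 < p.1) (h2 : 0 ≤ p.2) :
    p.1 ≤ 1 ∧ p.2 = |Real.sin (Real.pi / p.1)| := by
  rcases hp with (⟨a, ha, rfl⟩ | h) | h
  · exact ⟨ha.2, rfl⟩
  · exact absurd h.2 (not_lt.2 h2)
  · exact absurd h.1 h1.ne'

/-- coarse one-sided closeness -/
def RelK (k : ℕ) (F G : Set warsawCircle) : Prop :=
  ∀ p ∈ F, 0 < p.1.1 → 0 ≤ p.1.2 → (k : ℝ) + 2 ≤ p.1.1⁻¹ →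
    ∃ q ∈ G, 0 < q.1.1 ∧ 0 ≤ q.1.2 ∧ |p.1.1⁻¹ - q.1.1⁻¹| ≤ k

lemma RelK.trans {k l : ℕ} {F G H : Set warsawCircle} (h : RelK k F G) (h' : RelK l G H) :
    RelK (k + l) F H := by
  intro p hp h1 h2 h3
  push_cast at h3
  have hl : (0:ℝ) ≤ l := Nat.cast_nonneg l
  obtain ⟨q, hq, hq1, hq2, hq3⟩ := h p hp h1 h2 (by linarith)
  rw [abs_le] at hq3
  obtain ⟨z, hz, hz1, hz2, hz3⟩ := h' q hq hq1 hq2 (by linarith)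
  rw [abs_le] at hz3
  refine ⟨z, hz, hz1, hz2, ?_⟩
  push_cast
  rw [abs_le]
  constructor <;> linarith

def RelE (F G : Set warsawCircle) : Prop := (∃ k, RelK k F G) ∧ (∃ k, RelK k G F)

/-- open arc -/
def arcO (α β : ℝ) : Set warsawCircle :=
  {p | β⁻¹ < p.1.1 ∧ p.1.1 < α⁻¹ ∧ 0 ≤ p.1.2}

def arcC (α β : ℝ) : Set warsawCircle :=
  {p | β⁻¹ ≤ p.1.1 ∧ p.1.1 ≤ α⁻¹ ∧ 0 ≤ p.1.2}

lemma isClosed_arcC (α β : ℝ) : IsClosed (arcC α β) := by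
  have c1 : Continuous fun p : warsawCircle => p.1.1 := by fun_prop
  have c2 : Continuous fun p : warsawCircle => p.1.2 := by fun_prop
  exact (isClosed_le continuous_const c1).inter
    ((isClosed_le c1 continuous_const).inter (isClosed_le continuous_const c2))

lemma isOpen_arcO {α β : ℝ} (hα : 1 < α) (hβ : 0 < β) : IsOpen (arcO α β) := by
  have c1 : Continuous fun p : warsawCircle => p.1.1 := by fun_prop
  have c2 : Continuous fun p : warsawCircle => p.1.2 := by fun_prop
  have : arcO α β = {p | β⁻¹ < p.1.1} ∩ ({p | p.1.1 < α⁻¹} ∩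
      ({p | 0 < p.1.2} ∪ {p | (p.1.1 - 1/2)^2 + p.1.2^2 < 1/4})) := by
    ext ⟨p, hp⟩
    simp only [arcO, mem_setOf_eq, mem_inter_iff, mem_union]
    refine and_congr_right fun h1 => and_congr_right fun h2 => ?_
    have hb : 0 < β⁻¹ := inv_pos.2 hβ
    have ha : α⁻¹ < 1 := inv_lt_one_of_one_lt₀ hα
    constructor
    · intro h
      rcases h.lt_or_eq with h | h
      · exact Or.inl h
      · right
        rw [← h]
        nlinarith
    · rintro (h | h)
      · exact h.le
      · rcases hp with (⟨a, ha, rfl⟩ | h') | h'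
        · exact abs_nonneg _
        · linarith [h'.1]
        · exact h'.2.1
  rw [this]
  exact (isOpen_lt continuous_const c1).inter
    ((isOpen_lt c1 continuous_const).inter ((isOpen_lt continuous_const c2).union
      (isOpen_lt (by fun_prop) continuous_const)))

lemma local_rel {f : ℝ → Sc warsawCircle} (hf : Continuous f) {J : Set ℝ} (hJ : IsPreconnected J)
    {θ : ℝ} (h0 : 0 < θ) (h1 : θ < 1)
    (hav : ∀ t ∈ J, ∀ p ∈ (f t).1, p.1.2 ≠ Real.sin (Real.pi * θ)) {s t : ℝ} (hs : s ∈ J)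
    (ht : t ∈ J) : RelK 1 (f s).1 (f t).1 := by
  intro p hp hp1 hp2 hp3
  have hsin : ∀ n : ℕ, |Real.sin (Real.pi * (n + θ))| = Real.sin (Real.pi * θ) := by
    intro n
    have : Real.pi * (n + θ) = Real.pi * θ + n * Real.pi := by ring
    rw [this, Real.sin_add_nat_mul_pi, abs_mul, abs_pow, abs_neg, abs_one, one_pow, one_mul]
    apply abs_of_nonneg
    apply Real.sin_nonneg_of_nonneg_of_le_pi <;> nlinarith [Real.pi_pos]
  push_cast at hp3
  -- avoidance
  have hav' : ∀ t ∈ J, ∀ p ∈ (f t).1, 0 < p.1.1 → 0 ≤ p.1.2 → ∀ n : ℕ, p.1.1⁻¹ ≠ n + θ := by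
    intro t ht p hp h1 h2 n hn
    apply hav t ht p hp
    rw [(warsaw_pos p.2 h1 h2).2, div_eq_mul_inv, hn, hsin]
  set n := ⌊p.1.1⁻¹ - θ⌋₊ with hn
  have hn1 : (n:ℝ) ≤ p.1.1⁻¹ - θ := Nat.floor_le (by linarith)
  have hn2 : p.1.1⁻¹ - θ < n + 1 := Nat.lt_floor_add_one _
  have hn3 : (1:ℝ) ≤ n := by
    have : 1 ≤ n := Nat.le_floor (by push_cast; linarith)
    exact_mod_cast this
  have hα : (1:ℝ) < n + θ := by linarith
  have hβ : (0:ℝ) < (n + 1 : ℕ) + θ := by positivity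
  set α : ℝ := n + θ
  set β : ℝ := (n + 1 : ℕ) + θ
  have hO := isOpen_arcO hα hβ
  have hC := isClosed_arcC α β
  have hsub : arcO α β ⊆ arcC α β := fun q hq => ⟨hq.1.le, hq.2.1.le, hq.2.2⟩
  have hA := (isOpen_meet hO).preimage hf
  have hB := (isOpen_sub hC.isOpen_compl).preimage hf
  have hlt : J ⊆ f ⁻¹' {F | (F.1 ∩ arcO α β).Nonempty} := by
    refine hJ.subset_left_of_subset_union hA hB ?_ ?_ ⟨s, hs, ?_⟩
    · rw [Set.disjoint_left]
      rintro u ⟨q, hq, hq'⟩ hu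
      exact hu hq (hsub hq')
    · intro u hu
      by_cases h : (f u).1 ⊆ (arcC α β)ᶜ
      · exact Or.inr h
      · left
        rw [Set.not_subset] at h
        obtain ⟨q, hq, hq'⟩ := h
        rw [mem_compl_iff, not_not] at hq'
        have hq0 : 0 < q.1.1 := lt_of_lt_of_le (inv_pos.2 hβ) hq'.1
        refine ⟨q, hq, hq'.1.lt_of_ne ?_, hq'.2.1.lt_of_ne ?_, hq'.2.2⟩
        · intro h
          exact hav' u hu q hq hq0 hq'.2.2 (n+1) (by rw [← h, inv_inv])
        · intro h
          exact hav' u hu q hq hq0 hq'.2.2 n (by rw [h, inv_inv])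
    · refine ⟨p, hp, ?_, ?_, hp2⟩
      · rw [inv_lt_comm₀ hβ hp1]
        simp only [β]; push_cast; linarith
      · rw [lt_inv_comm₀ hp1 (by linarith)]
        exact lt_of_le_of_ne (by simp only [α]; linarith) (hav' s hs p hp hp1 hp2 n).symm
  obtain ⟨q, hq, hq1, hq2, hq3⟩ := hlt ht
  have hq0 : 0 < q.1.1 := lt_of_lt_of_le (inv_pos.2 hβ) hq1.le
  refine ⟨q, hq, hq0, hq3, ?_⟩
  rw [inv_lt_comm₀ hβ hq0] at hq1
  rw [lt_inv_comm₀ hq0 (by linarith)] at hq2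
  simp only [α, β] at hq1 hq2
  push_cast at hq1 ⊢
  rw [abs_le]
  constructor <;> linarith

lemma path_rel {f : ℝ → Sc warsawCircle} (hf : Continuous f) (s t : ℝ) :
    RelE (f s).1 (f t).1 := by
  refine isPreconnected_univ.induction₂ (fun s t => RelE (f s).1 (f t).1) ?_ ?_ ?_
    (mem_univ s) (mem_univ t)
  · intro x _
    rw [nhdsWithin_univ]
    obtain ⟨y, hy⟩ := (f x).2
    have hcount : ((fun p : warsawCircle => p.1.2) '' (f x).1).Countable := hy.2.1.image _
    obtain ⟨c, hc, hc'⟩ : ∃ c ∈ Ioo (0:ℝ) 1, c ∉ (fun p : warsawCircle => p.1.2) '' (f x).1 := by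
      by_contra! h
      have := hcount.mono (show Ioo (0:ℝ) 1 ⊆ _ from h)
      exact (Cardinal.Real.Ioo_countable_iff.1 this).not_gt one_pos
    have hθ : Real.sin (Real.pi * (Real.arcsin c / Real.pi)) = c := by
      rw [mul_div_cancel₀ _ Real.pi_ne_zero, Real.sin_arcsin (by linarith [hc.1]) hc.2.le]
    have h0 : 0 < Real.arcsin c / Real.pi := div_pos (Real.arcsin_pos.2 hc.1) Real.pi_pos
    have h1 : Real.arcsin c / Real.pi < 1 := by
      rw [div_lt_one Real.pi_pos]
      linarith [Real.arcsin_le_pi_div_two c, Real.pi_pos]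
    have c2 : Continuous fun p : warsawCircle => p.1.2 := by fun_prop
    have hU : IsOpen {p : warsawCircle | p.1.2 ≠ c} := isOpen_ne_fun c2 continuous_const
    have hV := (isOpen_sub hU).preimage hf
    have hx : x ∈ f ⁻¹' {F | F.1 ⊆ {p : warsawCircle | p.1.2 ≠ c}} :=
      fun p hp h => hc' ⟨p, hp, h⟩
    obtain ⟨ε, hε, hb⟩ := Metric.isOpen_iff.1 hV x hx
    filter_upwards [Metric.ball_mem_nhds x hε] with y hy
    have hJ : IsPreconnected (Metric.ball x ε) := (convex_ball x ε).isPreconnected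
    have hav : ∀ t ∈ Metric.ball x ε, ∀ p ∈ (f t).1,
        p.1.2 ≠ Real.sin (Real.pi * (Real.arcsin c / Real.pi)) := by
      intro t ht p hp
      rw [hθ]
      exact hb ht hp
    exact ⟨⟨1, local_rel hf hJ h0 h1 hav (Metric.mem_ball_self hε) hy⟩,
      ⟨1, local_rel hf hJ h0 h1 hav hy (Metric.mem_ball_self hε)⟩⟩
  · rintro x y z _ _ _ ⟨⟨k, hk⟩, ⟨l, hl⟩⟩ ⟨⟨k', hk'⟩, ⟨l', hl'⟩⟩
    exact ⟨⟨_, hk.trans hk'⟩, ⟨_, hl'.trans hl⟩⟩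
  · rintro x y _ _ ⟨h, h'⟩
    exact ⟨h', h⟩

lemma joined_rel {S T : Sc warsawCircle} (h : Joined S T) : RelE S.1 T.1 := by
  obtain ⟨γ⟩ := h
  have := path_rel γ.continuous_extend 0 1
  rwa [γ.extend_zero, γ.extend_one] at this

noncomputable def idx (r : ℝ) (n : ℕ) : ℕ := ⌊r * 4 ^ n⌋₊

lemma idx_bd {r : ℝ} (hr : r ∈ Ioo (1:ℝ) 2) (n : ℕ) :
    (4:ℝ) ^ n ≤ idx r n ∧ (idx r n : ℝ) ≤ r * 4 ^ n ∧ r * 4 ^ n - 1 < idx r n ∧ 1 ≤ idx r n := by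
  have h4 : (1:ℝ) ≤ 4 ^ n := one_le_pow₀ (by norm_num)
  have h : 4 ^ n ≤ idx r n := Nat.le_floor (by push_cast; nlinarith [hr.1])
  have h' : (4:ℝ) ^ n ≤ idx r n := by exact_mod_cast h
  refine ⟨h', Nat.floor_le (by nlinarith [hr.1]), Nat.sub_one_lt_floor _, ?_⟩
  exact le_trans Nat.one_le_two_pow (le_trans (Nat.pow_le_pow_left (by norm_num) n) h)

lemma warsaw_zero : ((0:ℝ), (0:ℝ)) ∈ warsawCircle := Or.inr ⟨rfl, le_rfl, zero_le_one⟩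

lemma warsaw_inv {m : ℕ} (hm : 1 ≤ m) : ((m:ℝ)⁻¹, (0:ℝ)) ∈ warsawCircle := by
  have hm' : (1:ℝ) ≤ m := by exact_mod_cast hm
  refine Or.inl (Or.inl ⟨(m:ℝ)⁻¹, ⟨inv_pos.2 (by linarith), inv_le_one_of_one_le₀ hm'⟩, ?_⟩)
  rw [div_inv_eq_mul, mul_comm, Real.sin_nat_mul_pi, abs_zero]

noncomputable def seqf (r : Ioo (1:ℝ) 2) (n : ℕ) : warsawCircle :=
  ⟨((idx r n : ℝ)⁻¹, 0), warsaw_inv (idx_bd r.2 n).2.2.2⟩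

lemma idx_lt {r s : ℝ} (hr : r ∈ Ioo (1:ℝ) 2) (hs : s ∈ Ioo (1:ℝ) 2) {n m : ℕ} (h : n < m) :
    (4:ℝ)^m ≤ 2 * (idx s m - idx r n) := by
  have h1 := (idx_bd hs m).1
  have h2 := (idx_bd hr n).2.1
  have h3 : (4:ℝ) ^ (n+1) ≤ 4 ^ m := pow_le_pow_right₀ (by norm_num) h
  have h4 : (0:ℝ) < 4 ^ n := by positivity
  rw [pow_succ] at h3
  nlinarith [hr.2]

lemma seqf_ncs (r : Ioo (1:ℝ) 2) :
    IsNCS (insert ⟨(0, 0), warsaw_zero⟩ (range (seqf r))) ⟨(0, 0), warsaw_zero⟩ := by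
  apply isNCS_of_seq
  · have : StrictMono (idx r) := by
      intro n m h
      have h1 := idx_lt r.2 r.2 h
      have h4 : (0:ℝ) < 4 ^ m := by positivity
      have : (idx r n : ℝ) < idx r m := by linarith
      exact_mod_cast this
    intro n m h
    simp only [seqf, Subtype.mk.injEq, Prod.mk.injEq, and_true, inv_inj, Nat.cast_inj] at h
    exact this.injective h
  · intro n h
    simp only [seqf, Subtype.mk.injEq, Prod.mk.injEq, and_true, inv_eq_zero, Nat.cast_eq_zero] at h
    have := (idx_bd r.2 n).2.2.2
    omega
  · rw [tendsto_subtype_rng]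
    refine Filter.Tendsto.prodMk_nhds ?_ tendsto_const_nhds
    refine tendsto_inv_atTop_zero.comp ?_
    exact Filter.tendsto_atTop_mono (fun n => (idx_bd r.2 n).1)
      (tendsto_pow_atTop_atTop_of_one_lt (by norm_num))

noncomputable def scf (r : Ioo (1:ℝ) 2) : Sc warsawCircle := ⟨_, _, seqf_ncs r⟩

lemma scf_rel {r s : Ioo (1:ℝ) 2} (h : RelE (scf r).1 (scf s).1) : r = s := by
  by_contra hne
  obtain ⟨⟨k, hk⟩, -⟩ := h
  have hd : 0 < |(r:ℝ) - s| := abs_pos.2 (sub_ne_zero.2 fun h => hne (Subtype.ext h))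
  obtain ⟨n, hn1, hn2⟩ : ∃ n : ℕ, 2 * (k:ℝ) + 2 < 4 ^ n ∧ (k:ℝ) + 2 < |(r:ℝ) - s| * 4 ^ n := by
    have ht : Filter.Tendsto (fun n : ℕ => (4:ℝ) ^ n) Filter.atTop Filter.atTop :=
      tendsto_pow_atTop_atTop_of_one_lt (by norm_num)
    exact ((ht.eventually_gt_atTop _).and
      ((ht.const_mul_atTop hd).eventually_gt_atTop _)).exists
  have b := idx_bd r.2 n
  have hidx : (0:ℝ) < idx r n := by have := b.2.2.2; exact_mod_cast this
  have hk0 : (0:ℝ) ≤ k := Nat.cast_nonneg k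
  obtain ⟨q, hq, hq1, hq2, hq3⟩ := hk (seqf r n) (Or.inr ⟨n, rfl⟩) (inv_pos.2 hidx) le_rfl (by
    show _ ≤ ((idx r n : ℝ)⁻¹)⁻¹
    rw [inv_inv]
    by_cases hk1 : k = 0
    · subst hk1
      have : (4:ℝ)^1 ≤ 4^n := by
        apply pow_le_pow_right₀ (by norm_num)
        by_contra h0
        have : n = 0 := by omega
        subst this
        norm_num at hn1
      push_cast; linarith [b.1]
    · linarith [b.1])
  rcases hq with rfl | ⟨m, rfl⟩
  · exact lt_irrefl _ hq1
  · change |((idx r n : ℝ)⁻¹)⁻¹ - ((idx s m : ℝ)⁻¹)⁻¹| ≤ k at hq3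
    rw [inv_inv, inv_inv] at hq3
    have hq4 := abs_le.1 hq3
    have b' := idx_bd s.2 m
    rcases lt_trichotomy n m with h | h | h
    · have h1 := idx_lt r.2 s.2 h
      have h3 : (4:ℝ) ^ n ≤ 4 ^ m := pow_le_pow_right₀ (by norm_num) h.le
      linarith
    · subst h
      have : |(r:ℝ) - s| * 4 ^ n = |(r:ℝ) * 4 ^ n - (s:ℝ) * 4 ^ n| := by
        rw [← sub_mul, abs_mul, abs_of_pos (show (0:ℝ) < 4 ^ n by positivity)]
      rw [this, lt_abs] at hn2
      rcases hn2 with h | h <;> linarith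
    · have h1 := idx_lt s.2 r.2 h
      linarith

lemma mk_Sc_le : Cardinal.mk (Sc warsawCircle) ≤ Cardinal.continuum := by
  have hex : ∀ S : Sc warsawCircle, ∃ f : ℕ → warsawCircle, S.1 = range f := by
    intro S
    obtain ⟨x, hx⟩ := S.2
    exact hx.2.1.exists_eq_range ⟨x, hx.2.2.2.1⟩
  choose f hf using hex
  have hinj : Function.Injective f := by
    intro S T h
    apply Subtype.ext
    rw [hf S, hf T, h]
  have hX : Cardinal.mk warsawCircle ≤ Cardinal.continuum := by
    refine (Cardinal.mk_set_le _).trans ?_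
    simp [Cardinal.mk_real]
  refine (Cardinal.mk_le_of_injective hinj).trans ?_
  calc Cardinal.mk (ℕ → warsawCircle) = Cardinal.mk warsawCircle ^ Cardinal.aleph0 := by simp
    _ ≤ Cardinal.continuum ^ Cardinal.aleph0 := Cardinal.power_le_power_right hX
    _ = Cardinal.continuum := Cardinal.continuum_power_aleph0

/-- The hyperspace `S_c(X)` of the Warsaw circle has exactly `𝔠`-many path-wise
connected components. -/
theorem stmt_19 :
    Cardinal.mk
      (Set.range (fun S : Sc ↥warsawCircle => pathComponent S)) =
      Cardinal.continuum := by
  apply le_antisymm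
  · exact Cardinal.mk_range_le.trans mk_Sc_le
  · rw [← Cardinal.mk_Ioo_real (show (1:ℝ) < 2 by norm_num)]
    refine Cardinal.mk_le_of_injective
      (f := fun r : Ioo (1:ℝ) 2 => (⟨pathComponent (scf r), scf r, rfl⟩ :
        Set.range (fun S : Sc ↥warsawCircle => pathComponent S))) ?_
    intro r s h
    have h' : pathComponent (scf r) = pathComponent (scf s) := congrArg Subtype.val h
    have h2 : scf s ∈ pathComponent (scf r) := by
      rw [h']; exact mem_pathComponent_self _
    exact scf_rel (joined_rel h2)
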